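/- arXiv:2004.02534 — 4 statements merged into one kernel-verified Lean document; each statement's English description precedes it below -/
import Mathlib

section
/- Every real number x ∈ [1/3, 2] is immortal for the multiplicative system S₀: there exists a biinfinite sequence (x_k)_{k∈ℤ} of reals with x₀ = x such that for every k ∈ ℤ, either x_k ∈ [1/3,1] and x_{k+1} = 2 x_k, or x_k ∈ [1,2] and x_{k+1} = x_k/3. -/
/-- A relation that is total in both directions admits a biinfinite chain through every point. -/
theorem exists_int_chain {α : Type*} {r : α → α → Prop} (hsucc : ∀ a, ∃ b, r a b)
    (hpred : ∀ b, ∃ a, r a b) (a : α) : ∃ f : ℤ → α, f 0 = a ∧ ∀ k, r (f k) (f (k + 1)) := by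
  choose s hs using hsucc
  choose p hp using hpred
  refine ⟨fun k => match k with
    | Int.ofNat n => s^[n] a
    | Int.negSucc n => p^[n + 1] a, rfl, ?_⟩
  rintro (n | _ | n)
  · change r (s^[n] a) (s^[n + 1] a)
    rw [Function.iterate_succ_apply']
    exact hs _
  · exact hp a
  · change r (p^[n + 1 + 1] a) (p^[n + 1] a)
    rw [Function.iterate_succ_apply' p (n + 1)]
    exact hp _

/-- Every `x ∈ [1/3, 2]` is immortal for the multiplicative system
`S₀ = {f₁ : [1/3,1] → [2/3,2], x ↦ 2x ; f₂ : [1,2] → [1/3,2/3], x ↦ x/3}`: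
there is a biinfinite orbit through `x`. -/
theorem S0_immortal (x : ℝ) (hx : x ∈ Set.Icc (1/3 : ℝ) 2) :
    ∃ f : ℤ → ℝ, f 0 = x ∧
      ∀ k : ℤ,
        (f k ∈ Set.Icc (1/3 : ℝ) 1 ∧ f (k + 1) = 2 * f k) ∨
        (f k ∈ Set.Icc (1 : ℝ) 2 ∧ f (k + 1) = f k / 3) := by
  obtain ⟨f, hf0, hf⟩ := exists_int_chain (α := Set.Icc (1/3 : ℝ) 2)
    (r := fun a b => ((a : ℝ) ∈ Set.Icc (1/3 : ℝ) 1 ∧ (b : ℝ) = 2 * a) ∨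
      ((a : ℝ) ∈ Set.Icc (1 : ℝ) 2 ∧ (b : ℝ) = a / 3))
    (fun ⟨y, h₁, h₂⟩ => by
      rcases le_total y 1 with h | h
      · exact ⟨⟨2 * y, by linarith, by linarith⟩, Or.inl ⟨⟨h₁, h⟩, rfl⟩⟩
      · exact ⟨⟨y / 3, by linarith, by linarith⟩, Or.inr ⟨⟨h, h₂⟩, rfl⟩⟩)
    (fun ⟨y, h₁, h₂⟩ => by
      rcases le_total y (2/3) with h | h
      · exact ⟨⟨3 * y, by linarith, by linarith⟩,
          Or.inr ⟨⟨by linarith, by linarith⟩, by ring⟩⟩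
      · exact ⟨⟨y / 2, by linarith, by linarith⟩,
          Or.inl ⟨⟨by linarith, by linarith⟩, by ring⟩⟩)
    ⟨x, hx⟩
  exact ⟨fun k => f k, congrArg Subtype.val hf0, hf⟩
end

section
/- Fix an integer n ≥ 3. The substitution σ₁, extended to biinfinite words, has exactly one fixpoint: there is a unique u ∈ {0,1}^ℤ with σ₁(u) = u. -/
/-- The letter at position `i` (indexed from `0`) of the length-`n` word `σ_r(c)`,
where `σ_r(0) = 0^{n-r-1} 1 0^r` and `σ_r(1) = 0^n`: it is `1` iff `c = 0` and
`i = n - 1 - r`. -/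
def sigmaLetter (n r : ℕ) (c : Fin 2) (i : ℕ) : Fin 2 :=
  if c = 0 ∧ i = n - 1 - r then 1 else 0

/-- The extension of `σ_r` to biinfinite words `u ∈ {0,1}^ℤ`, determined by
`σ_r(u)_{nj+i} = σ_r(u_j)_i` for `j ∈ ℤ` and `0 ≤ i ≤ n−1`. -/
def sigmaBi (n r : ℕ) (u : ℤ → Fin 2) : ℤ → Fin 2 :=
  fun k => sigmaLetter n r (u (k / (n : ℤ))) (k % (n : ℤ)).toNat

theorem natAbs_ediv_lt_of_emod_eq {n k : ℤ} (hn : 3 ≤ n) (hk : k % n = n - 2) :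
    (k / n).natAbs < k.natAbs := by
  have hdiv := Int.mul_ediv_add_emod k n
  rw [hk] at hdiv
  generalize k / n = q at hdiv ⊢
  rcases le_or_gt 0 q with hq | hq
  · have : 3 * q ≤ n * q := by gcongr
    omega
  · have : n * (q + 1) ≤ 3 * (q + 1) := mul_le_mul_of_nonpos_right hn (by omega)
    rw [mul_add, mul_one] at this
    omega

theorem sigmaBi_one_apply {n : ℕ} (hn : 3 ≤ n) (u : ℤ → Fin 2) (k : ℤ) :
    sigmaBi n 1 u k = if k % (n : ℤ) = n - 2 then (if u (k / n) = 0 then 1 else 0) else 0 := by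
  have hnonneg : 0 ≤ k % (n : ℤ) := Int.emod_nonneg _ (by omega)
  have hiff : (k % (n : ℤ)).toNat = n - 1 - 1 ↔ k % (n : ℤ) = n - 2 := by omega
  simp only [sigmaBi, sigmaLetter, hiff]
  split_ifs <;> simp_all

/-- The letter at position `k` of the fixpoint of `σ₁`, computed by desubstitution. -/
def sigmaOneFixpoint (n : ℕ) (k : ℤ) : Fin 2 :=
  if _h : 3 ≤ n ∧ k % (n : ℤ) = n - 2 then
    if sigmaOneFixpoint n (k / n) = 0 then 1 else 0
  else 0
termination_by k.natAbs
decreasing_by exact natAbs_ediv_lt_of_emod_eq (by omega) _h.2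

theorem sigmaBi_one_sigmaOneFixpoint {n : ℕ} (hn : 3 ≤ n) :
    sigmaBi n 1 (sigmaOneFixpoint n) = sigmaOneFixpoint n := by
  funext k
  rw [sigmaBi_one_apply hn, sigmaOneFixpoint.eq_1 n k]
  simp only [hn, true_and, dite_eq_ite]

theorem eq_of_sigmaBi_one_eq_self {n : ℕ} (hn : 3 ≤ n) {u v : ℤ → Fin 2}
    (hu : sigmaBi n 1 u = u) (hv : sigmaBi n 1 v = v) : u = v := by
  funext k
  induction hm : k.natAbs using Nat.strong_induction_on generalizing k with
  | _ m ih =>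
    rw [← congrFun hu k, ← congrFun hv k, sigmaBi_one_apply hn, sigmaBi_one_apply hn]
    by_cases hk : k % (n : ℤ) = n - 2
    · rw [ih _ (hm ▸ natAbs_ediv_lt_of_emod_eq (by omega) hk) _ rfl]
    · rw [if_neg hk, if_neg hk]

/-- For `n ≥ 3`, the substitution `σ₁` has a unique biinfinite fixpoint. -/
theorem sigma1_unique_fixpoint (n : ℕ) (hn : 3 ≤ n) :
    ∃! u : ℤ → Fin 2, sigmaBi n 1 u = u := by
  exact ⟨sigmaOneFixpoint n, sigmaBi_one_sigmaOneFixpoint hn,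
    fun _ hu => eq_of_sigmaBi_one_eq_self hn hu (sigmaBi_one_sigmaOneFixpoint hn)⟩
end

section
/- For n = 2, the substitution σ₁ (extended to biinfinite words) has no fixpoint: there is no u ∈ {0,1}^ℤ with σ₁(u) = u; but its square σ₁² = σ₁ ∘ σ₁ has exactly two fixpoints u ∈ {0,1}^ℤ with σ₁(σ₁(u)) = u. -/
/-- The biinfinite word with letter `c` at `0` whose letter at `k ≠ 0` is `0` or `1` according to
whether the exponent of `2` in `k` is even or odd. -/
def twoAdicParityWord (c : Fin 2) (k : ℤ) : Fin 2 :=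
  if k = 0 then c
  else if k % 4 = 0 then twoAdicParityWord c (k / 4)
  else if k % 4 = 2 then 1 else 0
termination_by k.natAbs
decreasing_by omega

theorem sigmaBi_two_one (u : ℤ → Fin 2) (k : ℤ) :
    sigmaBi 2 1 u k = if u (k / 2) = 0 ∧ k % 2 = 0 then 1 else 0 := by
  have h : (k % 2).toNat = 0 ↔ k % 2 = 0 := by omega
  simp only [sigmaBi, sigmaLetter, Nat.cast_ofNat, Nat.sub_self, Nat.add_one_sub_one, h]

theorem sigmaBi_two_one_sq (u : ℤ → Fin 2) (k : ℤ) :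
    sigmaBi 2 1 (sigmaBi 2 1 u) k =
      if k % 4 = 0 then u (k / 4) else if k % 4 = 2 then 1 else 0 := by
  have hdiv : k / 2 / 2 = k / 4 := by omega
  rw [sigmaBi_two_one, sigmaBi_two_one, hdiv]
  have hc : u (k / 4) = 0 ∨ u (k / 4) = 1 := by omega
  have hk : k % 4 = 0 ∧ k % 2 = 0 ∧ k / 2 % 2 = 0 ∨ k % 4 = 2 ∧ k % 2 = 0 ∧ k / 2 % 2 = 1 ∨
      k % 4 ≠ 0 ∧ k % 4 ≠ 2 ∧ k % 2 = 1 := by omega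
  rcases hk with ⟨h₁, h₂, h₃⟩ | ⟨h₁, h₂, h₃⟩ | ⟨h₁, h₂, h₃⟩ <;>
    rcases hc with hc | hc <;> simp [*]

theorem twoAdicParityWord_zero (c : Fin 2) : twoAdicParityWord c 0 = c := by
  rw [twoAdicParityWord, if_pos rfl]

theorem sigmaBi_sq_twoAdicParityWord (c : Fin 2) :
    sigmaBi 2 1 (sigmaBi 2 1 (twoAdicParityWord c)) = twoAdicParityWord c := by
  funext k
  rw [sigmaBi_two_one_sq]
  by_cases hk : k = 0
  · simp [hk]
  · conv_rhs => rw [twoAdicParityWord, if_neg hk]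

/-- A fixpoint of `σ₁²` is determined by its letter at `0`. -/
theorem eq_of_sigmaBi_sq_fixed {v w : ℤ → Fin 2} (hv : sigmaBi 2 1 (sigmaBi 2 1 v) = v)
    (hw : sigmaBi 2 1 (sigmaBi 2 1 w) = w) (h₀ : v 0 = w 0) : v = w := by
  funext k
  induction hm : k.natAbs using Nat.strong_induction_on generalizing k with
  | _ m ih =>
    by_cases hk : k = 0
    · rw [hk, h₀]
    · rw [← hv, ← hw, sigmaBi_two_one_sq, sigmaBi_two_one_sq]
      split_ifs with h₄
      · exact ih (k / 4).natAbs (by omega) (k / 4) rfl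
      · rfl
      · rfl

/-- For `n = 2`, the substitution `σ₁` has no biinfinite fixpoint, but its square
`σ₁²` has exactly two fixpoints. -/
theorem sigma1_n2_fixpoints :
    (¬ ∃ u : ℤ → Fin 2, sigmaBi 2 1 u = u) ∧
    (∃ u v : ℤ → Fin 2, u ≠ v ∧
      sigmaBi 2 1 (sigmaBi 2 1 u) = u ∧ sigmaBi 2 1 (sigmaBi 2 1 v) = v ∧
      ∀ w : ℤ → Fin 2, sigmaBi 2 1 (sigmaBi 2 1 w) = w → w = u ∨ w = v) := by
  refine ⟨?_, twoAdicParityWord 0, twoAdicParityWord 1, ?_, sigmaBi_sq_twoAdicParityWord 0,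
    sigmaBi_sq_twoAdicParityWord 1, fun w hw => ?_⟩
  · rintro ⟨u, hu⟩
    have h := congrFun hu 0
    rw [sigmaBi_two_one] at h
    have hc : u 0 = 0 ∨ u 0 = 1 := by omega
    rcases hc with hc | hc <;> simp [hc] at h
  · intro h
    have h₀ := congrFun h 0
    simp [twoAdicParityWord_zero] at h₀
  · have hc : w 0 = 0 ∨ w 0 = 1 := by omega
    refine hc.imp (fun h => ?_) (fun h => ?_) <;>
      exact eq_of_sigmaBi_sq_fixed hw (sigmaBi_sq_twoAdicParityWord _)
        (h.trans (twoAdicParityWord_zero _).symm)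
end

section
/- Fix an integer n ≥ 2. For every k ≥ 1 and all indices i₁, …, i_k ∈ {0,…,n−1}, every fixpoint of the composition s = σ_{i_k} ∘ ⋯ ∘ σ_{i_1} (extended to biinfinite words) is aperiodic: if u ∈ {0,1}^ℤ satisfies s(u) = u, then there is no integer p ≥ 1 with u_{j+p} = u_j for all j ∈ ℤ. -/
theorem sigmaBi_eq_one_iff (n r : ℕ) (u : ℤ → Fin 2) (k : ℤ) :
    sigmaBi n r u k = 1 ↔ u (k / n) = 0 ∧ (k % (n : ℤ)).toNat = n - 1 - r := by
  simp [sigmaBi, sigmaLetter]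

theorem exists_sigmaBi_eq_zero {n : ℕ} (hn : 2 ≤ n) (r : ℕ) (u : ℤ → Fin 2) :
    ∃ j, sigmaBi n r u j = 0 := by
  by_contra! h
  have h1 : ∀ j, sigmaBi n r u j = 1 := fun j => Fin.eq_one_of_ne_zero _ (h j)
  have e0 := ((sigmaBi_eq_one_iff n r u 0).1 (h1 0)).2
  have e1 := ((sigmaBi_eq_one_iff n r u 1).1 (h1 1)).2
  rw [Int.emod_eq_of_lt (by omega) (by omega)] at e0 e1
  omega

/-- A period of `σ_r(v)` is `n` times a period of `v`, unless `v` is constantly `1`. -/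
theorem exists_period_of_sigmaBi_periodic {n : ℕ} (hn : 2 ≤ n) (r : ℕ) (v : ℤ → Fin 2)
    (hv : ∃ j, v j = 0) (p : ℕ) (hp : ∀ j : ℤ, sigmaBi n r v (j + p) = sigmaBi n r v j) :
    ∃ q : ℕ, q * n = p ∧ ∀ j : ℤ, v (j + q) = v j := by
  obtain ⟨m, hm⟩ : ∃ m, n - 1 - r = m := ⟨_, rfl⟩
  have hmn : (m : ℤ) < n := by omega
  have hn0 : (n : ℤ) ≠ 0 := by omega
  have hdiv : ∀ j : ℤ, (m + n * j) / (n : ℤ) = j := fun j => by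
    rw [Int.add_mul_ediv_left _ _ hn0, Int.ediv_eq_zero_of_lt (by omega) hmn, zero_add]
  have hmod : ∀ j : ℤ, (m + n * j) % (n : ℤ) = m := fun j => by
    rw [Int.add_mul_emod_self_left, Int.emod_eq_of_lt (by omega) hmn]
  have key : ∀ j : ℤ, sigmaBi n r v (m + n * j) = 1 ↔ v j = 0 := fun j => by
    rw [sigmaBi_eq_one_iff, hdiv, hmod, hm]
    simp
  obtain ⟨j₀, hj₀⟩ := hv
  have hdvd : n ∣ p := by
    have h := (hp _).trans ((key j₀).2 hj₀)
    have h2 := ((sigmaBi_eq_one_iff _ _ _ _).1 h).2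
    have hnn := Int.emod_nonneg (m + n * j₀ + p : ℤ) hn0
    have h3 : (m + n * j₀ + p : ℤ) % n = (m + n * j₀) % n := by
      rw [hmod]; omega
    have h4 := Int.ModEq.dvd (Int.ModEq.symm h3)
    rw [add_sub_cancel_left] at h4
    exact_mod_cast h4
  obtain ⟨q, rfl⟩ := hdvd
  refine ⟨q, mul_comm _ _, fun j => ?_⟩
  have h0 : v (j + q) = 0 ↔ v j = 0 := by
    rw [← key, ← key, ← hp (m + n * j)]
    push_cast
    rw [mul_add, add_assoc]
  generalize v (j + q) = a at *
  generalize v j = b at *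
  revert a b
  decide

theorem exists_period_of_foldl_sigmaBi_periodic {n : ℕ} (hn : 2 ≤ n) (is : List ℕ)
    (v : ℤ → Fin 2) (hv : ∃ j, v j = 0) (p : ℕ)
    (hp : ∀ j : ℤ, is.foldl (fun v r => sigmaBi n r v) v (j + p) =
      is.foldl (fun v r => sigmaBi n r v) v j) :
    ∃ q : ℕ, q * n ^ is.length = p ∧ ∀ j : ℤ, v (j + q) = v j := by
  induction is generalizing v with
  | nil => exact ⟨p, by simp, hp⟩
  | cons r is ih =>
    obtain ⟨q, hq, hper⟩ := ih (sigmaBi n r v) (exists_sigmaBi_eq_zero hn r v) hp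
    obtain ⟨q', rfl, hper'⟩ := exists_period_of_sigmaBi_periodic hn r v hv q hper
    exact ⟨q', by rw [← hq, List.length_cons, pow_succ']; ring, hper'⟩

/-- Every biinfinite fixpoint of a nonempty composition `σ_{i_k} ∘ ⋯ ∘ σ_{i_1}` of the
substitutions `σ_r` (`r < n`) is aperiodic. Here the composition applied to `u` is
`is.foldl (fun v r => sigmaBi n r v) u`, i.e. `σ_{i_1}` is applied first. -/
theorem fixpoint_of_composition_aperiodic (n : ℕ) (hn : 2 ≤ n)
    (is : List ℕ) (hne : is ≠ []) (hlt : ∀ r ∈ is, r < n)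
    (u : ℤ → Fin 2) (hfix : is.foldl (fun v r => sigmaBi n r v) u = u) :
    ¬ ∃ p : ℕ, 1 ≤ p ∧ ∀ j : ℤ, u (j + p) = u j := by
  have hzero : ∃ j, u j = 0 := by
    rw [← hfix, ← List.dropLast_append_getLast hne, List.foldl_append]
    exact exists_sigmaBi_eq_zero hn _ _
  rintro ⟨p, hp, hper⟩
  induction p using Nat.strong_induction_on with
  | _ p ih =>
    obtain ⟨q, hq, hqper⟩ := exists_period_of_foldl_sigmaBi_periodic hn is u hzero p
      (by rwa [hfix])
    have hq0 : 1 ≤ q := by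
      rcases Nat.eq_zero_or_pos q with rfl | h
      · omega
      · exact h
    have hpow : 1 < n ^ is.length :=
      Nat.one_lt_pow (by simpa using hne) (by omega)
    exact ih q (by nlinarith) hq0 hqper
end
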